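/- Let N ≥ 3 and let W^N ∈ ℂ^{2^N} be the N-qubit W state. Then the partial trace of |W^N⟩⟨W^N| over the last N−2 qubits equals (2/N)·|ψ⁺⟩⟨ψ⁺| + (1 − 2/N)·|e₀₀⟩⟨e₀₀| as a 4×4 matrix, where ψ⁺ = (1/√2)(e₀₁ + e₁₀) ∈ ℂ⁴. -/

import Mathlib

open Matrix

/-- Standard basis vector labeled by an index `s`. -/
def basisVec {α : Type*} [DecidableEq α] (s : α) : α → ℂ := fun t => if t = s then 1 else 0

/-- The bit string with a single `1` at position `i`. -/
def oneAt {n : ℕ} (i : Fin n) : Fin n → Fin 2 := fun j => if j = i then 1 else 0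

/-- Partial trace over the second factor. -/
noncomputable def ptrace {α β : Type*} [Fintype β]
    (ρ : Matrix (α × β) (α × β) ℂ) : Matrix α α ℂ :=
  Matrix.of fun s t => ∑ u, ρ (s, u) (t, u)

/-- The `N`-qubit W state `(1/√N) ∑ₖ e_{δₖ}`, with the `N` bit positions split as
`2 + m`: vectors of `ℂ^{2^N}` are indexed by pairs of a 2-bit string and an
`m`-bit string. -/
noncomputable def Wsplit2 (N m : ℕ) : (Fin 2 → Fin 2) × (Fin m → Fin 2) → ℂ :=
  (Real.sqrt N : ℂ)⁻¹ •
    (∑ i : Fin 2, basisVec (oneAt i, fun _ => 0)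
      + ∑ j : Fin m, basisVec ((fun _ => 0), oneAt j))

/-- The Bell state `ψ⁺ = (e₀₁ + e₁₀)/√2`, indexed by 2-bit strings. -/
noncomputable def psiPlusBits : (Fin 2 → Fin 2) → ℂ :=
  (Real.sqrt 2 : ℂ)⁻¹ • (∑ i : Fin 2, basisVec (oneAt i))

lemma star_basisVec {α : Type*} [DecidableEq α] (s : α) : star (basisVec s) = basisVec s := by
  ext t
  by_cases h : t = s <;> simp [basisVec, h]

lemma sum_basisVec_mul_basisVec {α : Type*} [Fintype α] [DecidableEq α] (s t : α) :
    ∑ u, basisVec s u * basisVec t u = if s = t then 1 else 0 := by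
  simp [basisVec, eq_comm]

lemma oneAt_injective {n : ℕ} : Function.Injective (oneAt : Fin n → Fin n → Fin 2) := by
  intro i j h
  by_contra hij
  simpa [oneAt, hij] using congrFun h i

lemma oneAt_ne_zero {n : ℕ} (i : Fin n) : oneAt i ≠ fun _ => 0 := by
  intro h
  simpa [oneAt] using congrFun h i

lemma basisVec_prod {α β : Type*} [DecidableEq α] [DecidableEq β] (a s : α) (b u : β) :
    basisVec (a, b) (s, u) = basisVec a s * basisVec b u := by
  by_cases hs : s = a <;> simp [basisVec, hs]

lemma inv_ofReal_sqrt_mul_self (n : ℕ) :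
    (Real.sqrt n : ℂ)⁻¹ * (Real.sqrt n : ℂ)⁻¹ = (n : ℂ)⁻¹ := by
  rw [← mul_inv, ← Complex.ofReal_mul, Real.mul_self_sqrt n.cast_nonneg, Complex.ofReal_natCast]

lemma Wsplit2_apply (N m : ℕ) (s : Fin 2 → Fin 2) (u : Fin m → Fin 2) :
    Wsplit2 N m (s, u) = (Real.sqrt N : ℂ)⁻¹ *
      ((∑ i, basisVec (oneAt i) s) * basisVec (fun _ => 0) u
        + basisVec (fun _ => 0) s * ∑ j, basisVec (oneAt j) u) := by
  simp only [Wsplit2, Pi.smul_apply, Pi.add_apply, Finset.sum_apply, basisVec_prod, smul_eq_mul,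
    Finset.sum_mul, Finset.mul_sum]

lemma star_Wsplit2 (N m : ℕ) : star (Wsplit2 N m) = Wsplit2 N m := by
  simp [Wsplit2, star_smul, star_sum, star_basisVec]

lemma star_psiPlusBits : star psiPlusBits = psiPlusBits := by
  simp only [psiPlusBits, star_smul, star_sum, star_basisVec]
  simp

lemma sum_basisVec_zero_mul_sum_oneAt (m : ℕ) :
    ∑ u : Fin m → Fin 2, basisVec (fun _ => 0) u * ∑ j, basisVec (oneAt j) u = 0 := by
  simp only [Finset.mul_sum]
  rw [Finset.sum_comm]
  simp [sum_basisVec_mul_basisVec, (oneAt_ne_zero _).symm]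

lemma sum_sum_oneAt_mul_self (m : ℕ) :
    ∑ u : Fin m → Fin 2, (∑ j, basisVec (oneAt j) u) * ∑ j, basisVec (oneAt j) u = m := by
  simp only [Finset.sum_mul_sum]
  rw [Finset.sum_comm]
  simp_rw [Finset.sum_comm (s := (Finset.univ : Finset (Fin m → Fin 2))),
    sum_basisVec_mul_basisVec, oneAt_injective.eq_iff]
  simp

lemma sum_Wsplit2_mul_Wsplit2 (N m : ℕ) (s t : Fin 2 → Fin 2) :
    ∑ u, Wsplit2 N m (s, u) * Wsplit2 N m (t, u) = (N : ℂ)⁻¹ *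
      ((∑ i, basisVec (oneAt i) s) * (∑ i, basisVec (oneAt i) t)
        + m * (basisVec (fun _ => 0) s * basisVec (fun _ => 0) t)) := by
  have h00 := sum_basisVec_mul_basisVec (fun _ : Fin m => (0 : Fin 2)) (fun _ => 0)
  rw [if_pos rfl] at h00
  have h01 := sum_basisVec_zero_mul_sum_oneAt m
  have h11 := sum_sum_oneAt_mul_self m
  simp only [Wsplit2_apply]
  generalize (∑ i, basisVec (oneAt i) s) = a
  generalize (∑ i, basisVec (oneAt i) t) = b
  generalize basisVec (fun _ => 0) s = x
  generalize basisVec (fun _ => 0) t = y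
  rw [← inv_ofReal_sqrt_mul_self]
  generalize (Real.sqrt N : ℂ)⁻¹ = c
  generalize hp : (basisVec (fun _ => 0) : (Fin m → Fin 2) → ℂ) = p at *
  generalize hq : (fun u : Fin m → Fin 2 => ∑ j, basisVec (oneAt j) u) = q
  simp only [funext_iff] at hq
  simp only [hq] at *
  calc ∑ u, c * (a * p u + x * q u) * (c * (b * p u + y * q u))
      = ∑ u, (c * c * a * b * (p u * p u) + c * c * (a * y + x * b) * (p u * q u)
          + c * c * x * y * (q u * q u)) := Finset.sum_congr rfl fun u _ => by ring
    _ = c * c * (a * b + m * (x * y)) := by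
      rw [Finset.sum_add_distrib, Finset.sum_add_distrib, ← Finset.mul_sum, ← Finset.mul_sum,
        ← Finset.mul_sum, h00, h01, h11]
      ring

/-- for `N ≥ 3`, the partial trace of `|W^N⟩⟨W^N|` over the last
`N − 2` qubits equals `(2/N)|ψ⁺⟩⟨ψ⁺| + (1 − 2/N)|00⟩⟨00|`. -/
theorem persistency_stmt8 (N m : ℕ) (hN : 3 ≤ N) (hm : N = 2 + m) :
    ptrace (vecMulVec (Wsplit2 N m) (star (Wsplit2 N m)))
      = (2 / N : ℂ) • vecMulVec psiPlusBits (star psiPlusBits)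
        + (1 - 2 / N : ℂ) •
            vecMulVec (basisVec (fun _ => 0)) (star (basisVec (fun _ => 0))) := by
  have hN0 : (2 + m : ℂ) ≠ 0 := by exact_mod_cast (by omega : 2 + m ≠ 0)
  have h2 := inv_ofReal_sqrt_mul_self 2
  ext s t
  simp only [star_Wsplit2, star_psiPlusBits, star_basisVec, ptrace, of_apply, vecMulVec_apply,
    Matrix.add_apply, Matrix.smul_apply, smul_eq_mul, sum_Wsplit2_mul_Wsplit2]
  simp only [psiPlusBits, Pi.smul_apply, Finset.sum_apply, smul_eq_mul]
  rw [mul_mul_mul_comm]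
  push_cast at h2
  rw [h2, hm]
  push_cast
  field_simp
  ring
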